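/- For N point charges q₁,...,q_N at distinct points z₁,...,z_N ∈ ℝ³, with electric field E(x) = (1/4π) Σₙ qₙ (x−zₙ)/|x−zₙ|³, the cut-off field energy Ū(r) = (1/2)∫ E(x)² ∏ₙ θ(|x−zₙ|−r) d³x satisfies Ū(r) = (1/8πr) Σₙ qₙ² + (1/4π) Σ_{n<m} qₙq_m/|zₙ−z_m| + O(r) as r → 0⁺. -/

import Mathlib

open Filter Topology Asymptotics MeasureTheory

/-- Integration in polar coordinates of an integrable function. -/
theorem integral_eq_integral_toSphere {V : Type*} [NormedAddCommGroup V] [NormedSpace ℝ V]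
    [Nontrivial V] [FiniteDimensional ℝ V] [MeasurableSpace V] [BorelSpace V] (μ : Measure V)
    [μ.IsAddHaarMeasure] {f : V → ℝ} (hf : Integrable f μ) :
    (∀ᵐ ω : Metric.sphere (0 : V) 1 ∂μ.toSphere, IntegrableOn
      (fun s : ℝ => s ^ (Module.finrank ℝ V - 1) * f (s • (ω : V))) (Set.Ioi 0)) ∧
    ∫ x, f x ∂μ =
      ∫ ω : Metric.sphere (0 : V) 1,
        (∫ s in Set.Ioi (0 : ℝ), s ^ (Module.finrank ℝ V - 1) * f (s • (ω : V))) ∂μ.toSphere := by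
  set d := Module.finrank ℝ V - 1 with hd
  have mp := μ.measurePreserving_homeomorphUnitSphereProd
  have emb := (homeomorphUnitSphereProd V).measurableEmbedding
  set g : Metric.sphere (0 : V) 1 × Set.Ioi (0 : ℝ) → ℝ := fun p => f ((p.2 : ℝ) • (p.1 : V))
    with hg
  have hgf : ∀ x, g (homeomorphUnitSphereProd V x) = f x := by
    intro x
    have : ‖(x : V)‖ ≠ 0 := norm_ne_zero_iff.2 x.2
    simp [hg, smul_smul, this]
  have key : ∀ F : Set.Ioi (0 : ℝ) → ℝ,
      ∫ s, F s ∂Measure.volumeIoiPow d = ∫ s, (s : ℝ) ^ d * F s ∂(volume.comap Subtype.val) := by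
    intro F
    simp only [Measure.volumeIoiPow, ENNReal.ofReal]
    rw [integral_withDensity_eq_integral_smul]
    · refine integral_congr_ae (.of_forall fun s => ?_)
      simp only [NNReal.smul_def, smul_eq_mul]
      rw [Real.coe_toNNReal _ (pow_nonneg s.2.out.le _)]
    · exact (measurable_subtype_coe.pow_const _).real_toNNReal
  have hint : Integrable g (μ.toSphere.prod (Measure.volumeIoiPow d)) := by
    rw [← mp.integrable_comp_emb emb]
    have : g ∘ homeomorphUnitSphereProd V = f ∘ Subtype.val := funext hgf
    rw [this, ← integrableOn_iff_comap_subtypeVal (measurableSet_singleton _).compl]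
    exact hf.integrableOn
  constructor
  · filter_upwards [hint.prod_right_ae] with ω hω
    rw [integrableOn_iff_comap_subtypeVal measurableSet_Ioi]
    rw [Measure.volumeIoiPow, integrable_withDensity_iff_integrable_smul'] at hω
    · refine hω.congr (.of_forall fun s => ?_)
      simp [hg, ENNReal.toReal_ofReal (pow_nonneg s.2.out.le d)]
    · fun_prop
    · simp
  · calc
      ∫ x, f x ∂μ = ∫ x : ({(0)}ᶜ : Set V), f x ∂(μ.comap (↑)) := by
        rw [integral_subtype_comap (measurableSet_singleton _).compl, restrict_compl_singleton]
      _ = ∫ p, g p ∂μ.toSphere.prod (Measure.volumeIoiPow d) := by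
        rw [← mp.integral_comp emb]; simp only [hgf]
      _ = ∫ ω, (∫ s, g (ω, s) ∂Measure.volumeIoiPow d) ∂μ.toSphere := integral_prod _ hint
      _ = _ := by
        refine integral_congr_ae (.of_forall fun ω => ?_)
        simp only [key]
        exact integral_subtype_comap measurableSet_Ioi
          (fun s : ℝ => s ^ d * f (s • (ω : V)))

theorem toSphere_singleton {V : Type*} [NormedAddCommGroup V] [NormedSpace ℝ V]
    [FiniteDimensional ℝ V] [MeasurableSpace V] [BorelSpace V] (μ : Measure V)
    [μ.IsAddHaarMeasure] (hV : 1 < Module.finrank ℝ V) (ω : Metric.sphere (0 : V) 1) :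
    μ.toSphere {ω} = 0 := by
  rw [μ.toSphere_apply' (measurableSet_singleton _)]
  refine mul_eq_zero_of_right _ (measure_mono_null ?_
    (Measure.addHaar_submodule μ (Submodule.span ℝ {(ω : V)}) fun h => ?_))
  · rintro _ ⟨s, -, _, ⟨_, rfl, rfl⟩, rfl⟩
    exact Submodule.smul_mem _ _ (Submodule.mem_span_singleton_self _)
  · have := finrank_span_le_card (R := ℝ) ({(ω : V)} : Set V)
    rw [h, finrank_top] at this
    simp at this
    omega

theorem hasDerivAt_neg_inv_norm_smul_sub {V : Type*} [NormedAddCommGroup V]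
    [InnerProductSpace ℝ V] (ω a : V) (s : ℝ) (h : s • ω ≠ a) :
    HasDerivAt (fun s : ℝ => -‖s • ω - a‖⁻¹) (inner ℝ ω (s • ω - a) / ‖s • ω - a‖ ^ 3) s := by
  have h0 : ‖s • ω - a‖ ≠ 0 := norm_ne_zero_iff.2 (sub_ne_zero.2 h)
  have h1 : HasDerivAt (fun s : ℝ => s • ω - a) ω s := by
    simpa using ((hasDerivAt_id s).smul_const ω).sub_const a
  have h2 := (h1.norm_sq.sqrt (pow_ne_zero 2 h0))
  simp only [Real.sqrt_sq (norm_nonneg _)] at h2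
  refine (h2.inv h0).neg.congr_deriv ?_
  rw [real_inner_comm]
  field_simp

/-- The integral of a Coulomb force along a ray is the potential at its starting point. -/
theorem integral_Ioi_inner_div_norm_pow {V : Type*} [NormedAddCommGroup V]
    [InnerProductSpace ℝ V] (ω a : V) (hω : ‖ω‖ = 1) (h : ∀ s : ℝ, 0 ≤ s → s • ω ≠ a)
    (hi : IntegrableOn (fun s : ℝ => inner ℝ ω (s • ω - a) / ‖s • ω - a‖ ^ 3) (Set.Ioi 0)) :
    ∫ s in Set.Ioi (0 : ℝ), inner ℝ ω (s • ω - a) / ‖s • ω - a‖ ^ 3 = ‖a‖⁻¹ := by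
  have ht : Tendsto (fun s : ℝ => -‖s • ω - a‖⁻¹) atTop (𝓝 0) := by
    rw [← neg_zero]
    refine (tendsto_inv_atTop_zero.comp ?_).neg
    refine tendsto_atTop_mono (fun s => ?_) (tendsto_atTop_add_const_right atTop (-‖a‖) tendsto_id)
    have h1 := norm_sub_norm_le (s • ω) a
    have h2 : s ≤ ‖s • ω‖ := by rw [norm_smul, hω, mul_one]; exact le_abs_self s
    simp only [id]
    linarith
  rw [integral_Ioi_of_hasDerivAt_of_tendsto'
    (fun s hs => hasDerivAt_neg_inv_norm_smul_sub ω a s (h s hs)) hi ht]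
  simp

theorem toSphere_real_univ_fin_three :
    (volume : Measure (EuclideanSpace ℝ (Fin 3))).toSphere.real Set.univ = 4 * Real.pi := by
  rw [Measure.toSphere_real_apply_univ, measureReal_def, EuclideanSpace.volume_ball_fin_three]
  simp [ENNReal.toReal_ofReal (by positivity : 0 ≤ Real.pi * 4 / 3)]
  ring

theorem integral_inner_coulomb_zero (a : EuclideanSpace ℝ (Fin 3)) (ha : a ≠ 0)
    (hi : Integrable fun x : EuclideanSpace ℝ (Fin 3) =>
      inner ℝ x (x - a) / (‖x‖ ^ 3 * ‖x - a‖ ^ 3)) :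
    ∫ x : EuclideanSpace ℝ (Fin 3), inner ℝ x (x - a) / (‖x‖ ^ 3 * ‖x - a‖ ^ 3)
      = 4 * Real.pi / ‖a‖ := by
  obtain ⟨h1, h2⟩ := integral_eq_integral_toSphere volume hi
  have hV : Module.finrank ℝ (EuclideanSpace ℝ (Fin 3)) = 3 := by simp
  have heq : ∀ ω : Metric.sphere (0 : EuclideanSpace ℝ (Fin 3)) 1, Set.EqOn
      (fun s : ℝ => s ^ (Module.finrank ℝ (EuclideanSpace ℝ (Fin 3)) - 1) *
        (inner ℝ (s • (ω : EuclideanSpace ℝ (Fin 3))) (s • (ω : EuclideanSpace ℝ (Fin 3)) - a) /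
        (‖s • (ω : EuclideanSpace ℝ (Fin 3))‖ ^ 3 *
          ‖s • (ω : EuclideanSpace ℝ (Fin 3)) - a‖ ^ 3)))
      (fun s : ℝ => inner ℝ (ω : EuclideanSpace ℝ (Fin 3)) (s • (ω : EuclideanSpace ℝ (Fin 3)) - a)
        / ‖s • (ω : EuclideanSpace ℝ (Fin 3)) - a‖ ^ 3) (Set.Ioi 0) := by
    intro ω s hs
    have hs : 0 < s := hs
    have hω : ‖(ω : EuclideanSpace ℝ (Fin 3))‖ = 1 := by simp
    simp only [hV, inner_smul_left, norm_smul, hω, mul_one, Real.norm_eq_abs, abs_of_pos hs]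
    simp
    field_simp
  have hne : ∀ᵐ ω : Metric.sphere (0 : EuclideanSpace ℝ (Fin 3)) 1
      ∂(volume : Measure (EuclideanSpace ℝ (Fin 3))).toSphere,
      (ω : EuclideanSpace ℝ (Fin 3)) ≠ ‖a‖⁻¹ • a := by
    have hmem : ‖a‖⁻¹ • a ∈ Metric.sphere (0 : EuclideanSpace ℝ (Fin 3)) 1 := by
      simp [norm_smul, ha]
    have := toSphere_singleton (volume : Measure (EuclideanSpace ℝ (Fin 3))) (by simp) ⟨_, hmem⟩
    filter_upwards [compl_mem_ae_iff.2 this] with ω hω h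
    exact hω (Subtype.ext h)
  rw [h2, integral_congr_ae (g := fun _ => ‖a‖⁻¹), integral_const, toSphere_real_univ_fin_three]
  · simp [div_eq_mul_inv]
  filter_upwards [h1, hne] with ω hω hω'
  have hω1 : ‖(ω : EuclideanSpace ℝ (Fin 3))‖ = 1 := by simp
  rw [setIntegral_congr_fun measurableSet_Ioi (heq ω)]
  refine integral_Ioi_inner_div_norm_pow _ a hω1 ?_
    (hω.congr_fun (heq ω) measurableSet_Ioi)
  rintro s hs rfl
  apply hω'
  have hs0 : s ≠ 0 := by rintro rfl; simp at ha
  rw [norm_smul, hω1, mul_one, Real.norm_eq_abs, abs_of_nonneg hs, smul_smul,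
    inv_mul_cancel₀ hs0, one_smul]

theorem measureReal_ball_fin_three :
    (volume : Measure (EuclideanSpace ℝ (Fin 3))).real (Metric.ball 0 1) = 4 * Real.pi / 3 := by
  rw [measureReal_def, EuclideanSpace.volume_ball_fin_three]
  simp [ENNReal.toReal_ofReal (by positivity : 0 ≤ Real.pi * 4 / 3)]
  ring

theorem indicator_closedBall_inv_norm_sq (u : EuclideanSpace ℝ (Fin 3)) (r : ℝ) :
    (Metric.closedBall u r).indicator (fun x => (‖x - u‖ ^ 2)⁻¹) =
      fun x => (Set.Iic r).indicator (fun t : ℝ => (t ^ 2)⁻¹) ‖x - u‖ := by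
  ext x
  simp [Set.indicator, dist_eq_norm]

theorem radial_inv_sq_eqOn (r : ℝ) :
    Set.EqOn (fun t : ℝ => t ^ (Module.finrank ℝ (EuclideanSpace ℝ (Fin 3)) - 1) •
      (Set.Iic r).indicator (fun t : ℝ => (t ^ 2)⁻¹) t)
      ((Set.Iic r).indicator fun _ => (1 : ℝ)) (Set.Ioi 0) := by
  intro t ht
  have ht : 0 < t := ht
  by_cases h : t ≤ r
  · simp [h, ht.ne']
  · simp [h]

theorem integrableOn_inv_norm_sq_closedBall_self (u : EuclideanSpace ℝ (Fin 3)) (r : ℝ) :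
    IntegrableOn (fun x => (‖x - u‖ ^ 2)⁻¹) (Metric.closedBall u r) := by
  rw [← integrable_indicator_iff measurableSet_closedBall, indicator_closedBall_inv_norm_sq]
  refine Integrable.comp_sub_right (f := fun x : EuclideanSpace ℝ (Fin 3) =>
    (Set.Iic r).indicator (fun t : ℝ => (t ^ 2)⁻¹) ‖x‖) ?_ u
  rw [integrable_fun_norm_addHaar,
    integrableOn_congr_fun (radial_inv_sq_eqOn r) measurableSet_Ioi, IntegrableOn,
    integrable_indicator_iff measurableSet_Iic, IntegrableOn,
    Measure.restrict_restrict measurableSet_Iic, Set.Iic_inter_Ioi]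
  exact integrableOn_const (by simp)

theorem setIntegral_inv_norm_sq_closedBall_self (u : EuclideanSpace ℝ (Fin 3)) {r : ℝ}
    (hr : 0 ≤ r) :
    ∫ x in Metric.closedBall u r, (‖x - u‖ ^ 2)⁻¹ = 4 * Real.pi * r := by
  rw [← integral_indicator measurableSet_closedBall, indicator_closedBall_inv_norm_sq,
    integral_sub_right_eq_self (fun x : EuclideanSpace ℝ (Fin 3) =>
      (Set.Iic r).indicator (fun t : ℝ => (t ^ 2)⁻¹) ‖x‖) u, integral_fun_norm_addHaar,
    setIntegral_congr_fun measurableSet_Ioi (radial_inv_sq_eqOn r),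
    integral_indicator measurableSet_Iic,
    Measure.restrict_restrict measurableSet_Iic, Set.Iic_inter_Ioi, measureReal_ball_fin_three]
  simp [hr]
  ring

theorem inv_norm_sq_le_indicator_add (u x : EuclideanSpace ℝ (Fin 3)) {r : ℝ} (hr : 0 < r) :
    (‖x - u‖ ^ 2)⁻¹ ≤
      (Metric.closedBall u r).indicator (fun x => (‖x - u‖ ^ 2)⁻¹) x + (r ^ 2)⁻¹ := by
  by_cases h : x ∈ Metric.closedBall u r
  · rw [Set.indicator_of_mem h]
    have : 0 ≤ (r ^ 2)⁻¹ := by positivity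
    linarith
  · rw [Set.indicator_of_notMem h, zero_add]
    rw [Metric.mem_closedBall, dist_eq_norm, not_le] at h
    gcongr

theorem integrableOn_indicator_add_const (u p : EuclideanSpace ℝ (Fin 3)) (r c : ℝ) :
    IntegrableOn (fun x => (Metric.closedBall u r).indicator (fun x => (‖x - u‖ ^ 2)⁻¹) x + c)
      (Metric.closedBall p r) := by
  refine Integrable.add (Integrable.integrableOn ?_) (integrableOn_const ?_)
  · exact (integrable_indicator_iff measurableSet_closedBall).2
      (integrableOn_inv_norm_sq_closedBall_self u r)
  · exact measure_closedBall_lt_top.ne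

theorem integrableOn_inv_norm_sq_closedBall (u p : EuclideanSpace ℝ (Fin 3)) {r : ℝ}
    (hr : 0 < r) :
    IntegrableOn (fun x => (‖x - u‖ ^ 2)⁻¹) (Metric.closedBall p r) := by
  refine (integrableOn_indicator_add_const u p r (r ^ 2)⁻¹).mono'
    (by fun_prop : Measurable fun x : EuclideanSpace ℝ (Fin 3) =>
      (‖x - u‖ ^ 2)⁻¹).aestronglyMeasurable (.of_forall fun x => ?_)
  rw [Real.norm_of_nonneg (by positivity)]
  exact inv_norm_sq_le_indicator_add u x hr

theorem setIntegral_inv_norm_sq_closedBall_le (u p : EuclideanSpace ℝ (Fin 3)) {r : ℝ}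
    (hr : 0 < r) :
    ∫ x in Metric.closedBall p r, (‖x - u‖ ^ 2)⁻¹ ≤ 16 / 3 * Real.pi * r := by
  have hind : Integrable
      ((Metric.closedBall u r).indicator fun x : EuclideanSpace ℝ (Fin 3) => (‖x - u‖ ^ 2)⁻¹) :=
    (integrable_indicator_iff measurableSet_closedBall).2
      (integrableOn_inv_norm_sq_closedBall_self u r)
  calc
    _ ≤ ∫ x in Metric.closedBall p r,
        ((Metric.closedBall u r).indicator (fun x => (‖x - u‖ ^ 2)⁻¹) x + (r ^ 2)⁻¹) :=
      setIntegral_mono (integrableOn_inv_norm_sq_closedBall u p hr)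
        (integrableOn_indicator_add_const u p r _) fun x => inv_norm_sq_le_indicator_add u x hr
    _ = (∫ x in Metric.closedBall p r,
        (Metric.closedBall u r).indicator (fun x => (‖x - u‖ ^ 2)⁻¹) x)
          + 4 / 3 * Real.pi * r := by
      rw [integral_add hind.integrableOn (integrableOn_const measure_closedBall_lt_top.ne),
        setIntegral_const, measureReal_def, EuclideanSpace.volume_closedBall_fin_three]
      simp [ENNReal.toReal_ofReal (by positivity : 0 ≤ Real.pi * 4 / 3), hr.le]
      field_simp
    _ ≤ (∫ x, (Metric.closedBall u r).indicator (fun x => (‖x - u‖ ^ 2)⁻¹) x)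
          + 4 / 3 * Real.pi * r := by
      refine add_le_add_left (setIntegral_le_integral hind (.of_forall fun x => ?_)) _
      exact Set.indicator_nonneg (fun x _ => by positivity) x
    _ = 16 / 3 * Real.pi * r := by
      rw [integral_indicator measurableSet_closedBall,
        setIntegral_inv_norm_sq_closedBall_self u hr.le]
      ring

theorem indicator_inv_norm_pow_four (u : EuclideanSpace ℝ (Fin 3)) (r : ℝ) :
    {x | r < dist x u}.indicator (fun x => (‖x - u‖ ^ 2)⁻¹ * (‖x - u‖ ^ 2)⁻¹) =
      fun x => (Set.Ioi r).indicator (fun t : ℝ => (t ^ 2)⁻¹ * (t ^ 2)⁻¹) ‖x - u‖ := by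
  ext x
  simp [Set.indicator, dist_eq_norm]

theorem radial_inv_pow_four_eqOn (r : ℝ) :
    Set.EqOn (fun t : ℝ => t ^ (Module.finrank ℝ (EuclideanSpace ℝ (Fin 3)) - 1) •
      (Set.Ioi r).indicator (fun t : ℝ => (t ^ 2)⁻¹ * (t ^ 2)⁻¹) t)
      ((Set.Ioi r).indicator fun t => t ^ (-2 : ℝ)) (Set.Ioi 0) := by
  intro t ht
  have ht : 0 < t := ht
  by_cases h : r < t
  · simp [h, ht.ne']
  · simp [h]

theorem measurableSet_lt_dist (u : EuclideanSpace ℝ (Fin 3)) (r : ℝ) :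
    MeasurableSet {x | r < dist x u} :=
  measurableSet_lt measurable_const (by fun_prop)

theorem integrableOn_inv_norm_pow_four (u : EuclideanSpace ℝ (Fin 3)) {r : ℝ} (hr : 0 < r) :
    IntegrableOn (fun x => (‖x - u‖ ^ 2)⁻¹ * (‖x - u‖ ^ 2)⁻¹) {x | r < dist x u} := by
  rw [← integrable_indicator_iff (measurableSet_lt_dist u r), indicator_inv_norm_pow_four]
  refine Integrable.comp_sub_right (f := fun x : EuclideanSpace ℝ (Fin 3) =>
    (Set.Ioi r).indicator (fun t : ℝ => (t ^ 2)⁻¹ * (t ^ 2)⁻¹) ‖x‖) ?_ u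
  rw [integrable_fun_norm_addHaar,
    integrableOn_congr_fun (radial_inv_pow_four_eqOn r) measurableSet_Ioi, IntegrableOn,
    integrable_indicator_iff measurableSet_Ioi, IntegrableOn,
    Measure.restrict_restrict measurableSet_Ioi,
    Set.inter_eq_left.2 (Set.Ioi_subset_Ioi hr.le)]
  exact integrableOn_Ioi_rpow_of_lt (by norm_num) hr

theorem setIntegral_inv_norm_pow_four (u : EuclideanSpace ℝ (Fin 3)) {r : ℝ} (hr : 0 < r) :
    ∫ x in {x | r < dist x u}, (‖x - u‖ ^ 2)⁻¹ * (‖x - u‖ ^ 2)⁻¹ = 4 * Real.pi / r := by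
  rw [← integral_indicator (measurableSet_lt_dist u r), indicator_inv_norm_pow_four,
    integral_sub_right_eq_self (fun x : EuclideanSpace ℝ (Fin 3) =>
      (Set.Ioi r).indicator (fun t : ℝ => (t ^ 2)⁻¹ * (t ^ 2)⁻¹) ‖x‖) u, integral_fun_norm_addHaar,
    setIntegral_congr_fun measurableSet_Ioi (radial_inv_pow_four_eqOn r),
    integral_indicator measurableSet_Ioi,
    Measure.restrict_restrict measurableSet_Ioi,
    Set.inter_eq_left.2 (Set.Ioi_subset_Ioi hr.le),
    integral_Ioi_rpow_of_lt (by norm_num) hr, measureReal_ball_fin_three]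
  norm_num [Real.rpow_neg hr.le]
  field_simp

theorem inv_sq_mul_inv_sq_le {s t d : ℝ} (hs : 0 ≤ s) (ht : 0 ≤ t) (hd : 0 < d)
    (h : d ≤ s + t) :
    (s ^ 2)⁻¹ * (t ^ 2)⁻¹ ≤ (s ^ 2)⁻¹ * (2 * (s ^ 2 + (d / 2) ^ 2)⁻¹) +
      (t ^ 2)⁻¹ * (2 * (t ^ 2 + (d / 2) ^ 2)⁻¹) := by
  wlog hst : t ≤ s generalizing s t
  · have := this ht hs (by linarith) (not_le.1 hst).le
    linarith
  have h1 : d / 2 ≤ s := by linarith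
  have h2 : (s ^ 2)⁻¹ ≤ 2 * (t ^ 2 + (d / 2) ^ 2)⁻¹ := by
    rw [← div_eq_mul_inv, inv_eq_one_div, div_le_div_iff₀ (by nlinarith) (by positivity)]
    nlinarith
  have h3 : 0 ≤ (s ^ 2)⁻¹ * (2 * (s ^ 2 + (d / 2) ^ 2)⁻¹) := by positivity
  have h4 := mul_le_mul_of_nonneg_left h2 (by positivity : 0 ≤ (t ^ 2)⁻¹)
  linarith

theorem inv_sq_mul_inv_sq_le_mul_add {s t d : ℝ} (hs : 0 ≤ s) (ht : 0 ≤ t) (hd : 0 < d)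
    (h : d ≤ s + t) :
    (s ^ 2)⁻¹ * (t ^ 2)⁻¹ ≤ 8 / d ^ 2 * ((s ^ 2)⁻¹ + (t ^ 2)⁻¹) := by
  have key : ∀ t : ℝ, (t ^ 2)⁻¹ * (2 * (t ^ 2 + (d / 2) ^ 2)⁻¹) ≤ 8 / d ^ 2 * (t ^ 2)⁻¹ := by
    intro t
    rw [mul_comm]
    gcongr
    rw [← div_eq_mul_inv, div_le_div_iff₀ (by positivity) (by positivity)]
    nlinarith [sq_nonneg t]
  have := inv_sq_mul_inv_sq_le hs ht hd h
  have := key s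
  have := key t
  linarith

theorem integrable_inv_norm_sq_mul_lorentzian (u : EuclideanSpace ℝ (Fin 3)) {c : ℝ}
    (hc : 0 < c) :
    Integrable fun x => (‖x - u‖ ^ 2)⁻¹ * (2 * (‖x - u‖ ^ 2 + c ^ 2)⁻¹) := by
  refine Integrable.comp_sub_right (f := fun x : EuclideanSpace ℝ (Fin 3) =>
    (‖x‖ ^ 2)⁻¹ * (2 * (‖x‖ ^ 2 + c ^ 2)⁻¹)) ?_ u
  rw [integrable_fun_norm_addHaar volume (f := fun t : ℝ => (t ^ 2)⁻¹ * (2 * (t ^ 2 + c ^ 2)⁻¹))]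
  have h1 := ((integrable_inv_one_add_sq.comp_div hc.ne').const_mul (2 / c ^ 2)).integrableOn
    (s := Set.Ioi (0 : ℝ))
  refine h1.congr_fun (fun t ht => ?_) measurableSet_Ioi
  have ht : 0 < t := ht
  simp
  field_simp
  ring

theorem abs_inner_div_le {V : Type*} [NormedAddCommGroup V] [InnerProductSpace ℝ V] (a b : V) :
    |inner ℝ a b / (‖a‖ ^ 3 * ‖b‖ ^ 3)| ≤ (‖a‖ ^ 2)⁻¹ * (‖b‖ ^ 2)⁻¹ := by
  rcases eq_or_ne a 0 with rfl | ha
  · simp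
  rcases eq_or_ne b 0 with rfl | hb
  · simp
  have ha : 0 < ‖a‖ := norm_pos_iff.2 ha
  have hb : 0 < ‖b‖ := norm_pos_iff.2 hb
  rw [abs_div, abs_of_pos (by positivity : 0 < ‖a‖ ^ 3 * ‖b‖ ^ 3), div_le_iff₀ (by positivity)]
  refine (abs_real_inner_le_norm a b).trans_eq ?_
  field_simp

/-- The product of the Coulomb fields of unit charges at `u` and `v`, without prefactors. -/
noncomputable def coulombProduct (u v x : EuclideanSpace ℝ (Fin 3)) : ℝ :=
  inner ℝ (x - u) (x - v) / (‖x - u‖ ^ 3 * ‖x - v‖ ^ 3)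

theorem coulombProduct_self (u : EuclideanSpace ℝ (Fin 3)) :
    coulombProduct u u = fun x => (‖x - u‖ ^ 2)⁻¹ * (‖x - u‖ ^ 2)⁻¹ := by
  ext x
  rw [coulombProduct, real_inner_self_eq_norm_sq]
  rcases eq_or_ne ‖x - u‖ 0 with h | h
  · simp [h]
  · field_simp

theorem measurable_coulombProduct (u v : EuclideanSpace ℝ (Fin 3)) :
    Measurable (coulombProduct u v) := by
  unfold coulombProduct
  fun_prop

theorem integrable_coulombProduct {u v : EuclideanSpace ℝ (Fin 3)} (h : u ≠ v) :
    Integrable (coulombProduct u v) := by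
  have hd : 0 < dist u v := dist_pos.2 h
  refine ((integrable_inv_norm_sq_mul_lorentzian u (half_pos hd)).add
    (integrable_inv_norm_sq_mul_lorentzian v (half_pos hd))).mono'
    (measurable_coulombProduct u v).aestronglyMeasurable (.of_forall fun x => ?_)
  refine (abs_inner_div_le _ _).trans
    (inv_sq_mul_inv_sq_le (norm_nonneg _) (norm_nonneg _) hd ?_)
  rw [← dist_eq_norm, ← dist_eq_norm]
  exact dist_triangle_left u v x

theorem integral_coulombProduct {u v : EuclideanSpace ℝ (Fin 3)} (h : u ≠ v) :
    ∫ x, coulombProduct u v x = 4 * Real.pi / dist u v := by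
  have hi := (integrable_coulombProduct h).comp_add_right u
  have heq : (fun x => coulombProduct u v (x + u)) =
      fun x => inner ℝ x (x - (v - u)) / (‖x‖ ^ 3 * ‖x - (v - u)‖ ^ 3) := by
    ext x
    simp only [coulombProduct, add_sub_cancel_right]
    rw [show x + u - v = x - (v - u) by abel]
  rw [← integral_add_right_eq_self _ u, heq, dist_comm, dist_eq_norm]
  rw [heq] at hi
  exact integral_inner_coulomb_zero _ (sub_ne_zero.2 h.symm) hi

/-- Removing balls of radius `r` changes the integral of a function with inverse-square
singularities by `O(r)`. -/
theorem abs_setIntegral_sub_setIntegral_le {ι : Type*} [Fintype ι]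
    (z : ι → EuclideanSpace ℝ (Fin 3)) (u v : EuclideanSpace ℝ (Fin 3))
    {G : EuclideanSpace ℝ (Fin 3) → ℝ} {S : Set (EuclideanSpace ℝ (Fin 3))} {C r : ℝ}
    (hC : 0 ≤ C) (hr : 0 < r) (hS : {x | ∀ n, r < dist x (z n)} ⊆ S) (hSm : MeasurableSet S)
    (hG : IntegrableOn G S)
    (hb : ∀ x ∈ S, ∀ k, dist x (z k) ≤ r →
      |G x| ≤ C * ((‖x - u‖ ^ 2)⁻¹ + (‖x - v‖ ^ 2)⁻¹)) :
    |(∫ x in {x | ∀ n, r < dist x (z n)}, G x) - ∫ x in S, G x| ≤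
      Fintype.card ι * (C * (32 / 3 * Real.pi)) * r := by
  have hm : MeasurableSet {x | ∀ n, r < dist x (z n)} := by
    rw [Set.ofPred_forall]
    exact .iInter fun n => measurableSet_lt_dist (z n) r
  set Ω := {x | ∀ n, r < dist x (z n)} with hΩ
  set H : EuclideanSpace ℝ (Fin 3) → ℝ := fun x => C * ((‖x - u‖ ^ 2)⁻¹ + (‖x - v‖ ^ 2)⁻¹) with hH
  have hH0 : ∀ x, 0 ≤ H x := fun x => by positivity
  have hHi : ∀ k, IntegrableOn H (Metric.closedBall (z k) r) := fun k =>
    ((integrableOn_inv_norm_sq_closedBall u _ hr).add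
      (integrableOn_inv_norm_sq_closedBall v _ hr)).const_mul C
  rw [abs_sub_comm, ← setIntegral_sdiff hm hG hS, ← integral_indicator (hSm.diff hm),
    ← Real.norm_eq_abs]
  calc
    _ ≤ ∫ x, ∑ k, (Metric.closedBall (z k) r).indicator H x := by
      refine norm_integral_le_of_norm_le (integrable_finsetSum _ fun k _ =>
        (integrable_indicator_iff measurableSet_closedBall).2 (hHi k)) (.of_forall fun x => ?_)
      have hnn : ∀ k ∈ Finset.univ, 0 ≤ (Metric.closedBall (z k) r).indicator H x :=
        fun k _ => Set.indicator_nonneg (fun y _ => hH0 y) x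
      by_cases hx : x ∈ S \ Ω
      · rw [Set.indicator_of_mem hx]
        obtain ⟨k, hk⟩ : ∃ k, dist x (z k) ≤ r := by
          by_contra! hcon
          exact hx.2 hcon
        refine (hb x hx.1 k hk).trans ?_
        refine le_trans ?_ (Finset.single_le_sum hnn (Finset.mem_univ k))
        rw [Set.indicator_of_mem (Metric.mem_closedBall.2 hk)]
      · rw [Set.indicator_of_notMem hx, norm_zero]
        exact Finset.sum_nonneg hnn
    _ = ∑ k, ∫ x in Metric.closedBall (z k) r, H x := by
      rw [integral_finsetSum _ fun k _ =>
        (integrable_indicator_iff measurableSet_closedBall).2 (hHi k)]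
      exact Finset.sum_congr rfl fun k _ => integral_indicator measurableSet_closedBall
    _ ≤ ∑ _k : ι, C * (32 / 3 * Real.pi) * r := by
      refine Finset.sum_le_sum fun k _ => ?_
      rw [hH, integral_const_mul, integral_add (integrableOn_inv_norm_sq_closedBall u _ hr)
        (integrableOn_inv_norm_sq_closedBall v _ hr), mul_assoc]
      refine mul_le_mul_of_nonneg_left ?_ hC
      have h1 := setIntegral_inv_norm_sq_closedBall_le u (z k) hr
      have h2 := setIntegral_inv_norm_sq_closedBall_le v (z k) hr
      linarith
    _ = _ := by simp [mul_assoc]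

theorem exists_abs_setIntegral_coulombProduct_sub_le {ι : Type*} [Fintype ι] [DecidableEq ι]
    {z : ι → EuclideanSpace ℝ (Fin 3)} (hz : Function.Injective z) (n m : ι) :
    ∃ C : ℝ, ∀ r : ℝ, 0 < r →
      |(∫ x in {x | ∀ n, r < dist x (z n)}, coulombProduct (z n) (z m) x) -
        (if n = m then 4 * Real.pi / r else 4 * Real.pi / dist (z n) (z m))| ≤ C * r := by
  by_cases hnm : n = m
  · subst hnm
    set C := ∑ k, 4 / dist (z k) (z n) ^ 2 with hC
    have hC0 : 0 ≤ C := Finset.sum_nonneg fun k _ => by positivity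
    refine ⟨Fintype.card ι * (C * (32 / 3 * Real.pi)), fun r hr => ?_⟩
    rw [if_pos rfl, coulombProduct_self, ← setIntegral_inv_norm_pow_four (z n) hr]
    refine abs_setIntegral_sub_setIntegral_le z (z n) (z n) hC0 hr (fun x hx => hx n)
      (measurableSet_lt_dist _ _) (integrableOn_inv_norm_pow_four _ hr) fun x hx k hk => ?_
    have hx : r < dist x (z n) := hx
    have hkn : z k ≠ z n := by
      intro h
      rw [h] at hk
      linarith
    have hd : 0 < dist (z k) (z n) := dist_pos.2 hkn
    have htri := dist_triangle_left (z k) (z n) x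
    have hle : 4 / dist (z k) (z n) ^ 2 ≤ C :=
      Finset.single_le_sum (f := fun k => 4 / dist (z k) (z n) ^ 2)
        (fun k _ => by positivity) (Finset.mem_univ k)
    rw [abs_of_nonneg (by positivity)]
    rw [dist_eq_norm x (z n)] at hx htri
    have h1 : (‖x - z n‖ ^ 2)⁻¹ ≤ 4 / dist (z k) (z n) ^ 2 := by
      rw [inv_eq_one_div, div_le_div_iff₀ (by nlinarith) (by positivity)]
      nlinarith
    have h0 : 0 ≤ (‖x - z n‖ ^ 2)⁻¹ := by positivity
    nlinarith [mul_le_mul_of_nonneg_right (h1.trans hle) h0, mul_nonneg hC0 h0]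
  · have hne : z n ≠ z m := fun h => hnm (hz h)
    have hd : 0 < dist (z n) (z m) := dist_pos.2 hne
    refine ⟨Fintype.card ι * (8 / dist (z n) (z m) ^ 2 * (32 / 3 * Real.pi)), fun r hr => ?_⟩
    rw [if_neg hnm, ← integral_coulombProduct hne,
      ← setIntegral_univ (μ := volume) (f := coulombProduct (z n) (z m))]
    refine abs_setIntegral_sub_setIntegral_le z (z n) (z m)
      (C := 8 / dist (z n) (z m) ^ 2) (by positivity) hr
      (Set.subset_univ _) .univ (integrable_coulombProduct hne).integrableOn fun x _ k _ => ?_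
    refine (abs_inner_div_le _ _).trans
      (inv_sq_mul_inv_sq_le_mul_add (norm_nonneg _) (norm_nonneg _) hd ?_)
    rw [← dist_eq_norm, ← dist_eq_norm]
    exact dist_triangle_left _ _ x

theorem integrableOn_coulombProduct {ι : Type*} {z : ι → EuclideanSpace ℝ (Fin 3)}
    (hz : Function.Injective z) (n m : ι) {r : ℝ} (hr : 0 < r) :
    IntegrableOn (coulombProduct (z n) (z m)) {x | ∀ n, r < dist x (z n)} := by
  by_cases hnm : n = m
  · subst hnm
    rw [coulombProduct_self]
    exact (integrableOn_inv_norm_pow_four (z n) hr).mono_set fun x hx => hx n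
  · exact (integrable_coulombProduct fun h => hnm (hz h)).integrableOn

theorem norm_sq_sum_coulomb {ι : Type*} [Fintype ι] (q : ι → ℝ)
    (z : ι → EuclideanSpace ℝ (Fin 3)) (x : EuclideanSpace ℝ (Fin 3)) :
    ‖∑ n, (q n / ‖x - z n‖ ^ 3) • (x - z n)‖ ^ 2 =
      ∑ n, ∑ m, q n * q m * coulombProduct (z n) (z m) x := by
  rw [← real_inner_self_eq_norm_sq, sum_inner]
  refine Finset.sum_congr rfl fun n _ => ?_
  rw [inner_sum]
  refine Finset.sum_congr rfl fun m _ => ?_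
  rw [real_inner_smul_left, real_inner_smul_right, coulombProduct]
  simp only [div_eq_mul_inv, mul_inv]
  ring

theorem sum_sum_eq_sum_diag_add {N : ℕ} (f g : Fin N → Fin N → ℝ) (hg : ∀ n m, g n m = g m n) :
    ∑ n, ∑ m, (if n = m then f n m else g n m) =
      ∑ n, f n n + 2 * ∑ n, ∑ m, if n < m then g n m else 0 := by
  have h1 : ∀ n m : Fin N, (if n = m then f n m else g n m) =
      (if n = m then f n m else 0) + ((if n < m then g n m else 0) +
        if m < n then g m n else 0) := by
    intro n m
    rcases lt_trichotomy n m with h | h | h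
    · simp [h, h.ne, h.not_gt]
    · simp [h]
    · simp [h, h.ne', h.not_gt, hg n m]
  simp only [h1, Finset.sum_add_distrib]
  rw [Finset.sum_comm (f := fun n m : Fin N => if m < n then g m n else 0)]
  simp
  ring

/-- For `N` point charges `q₁,…,q_N` at distinct points `z₁,…,z_N ∈ ℝ³`, with
electric field `E(x) = (1/4π) Σₙ qₙ (x−zₙ)/|x−zₙ|³`, the cut-off field energy
`Ū(r) = (1/2) ∫_{∀n, |x−zₙ|>r} |E(x)|² d³x` satisfies
`Ū(r) = (1/8πr) Σₙ qₙ² + (1/4π) Σ_{n<m} qₙ q_m/|zₙ−z_m| + O(r)` as `r → 0⁺`. -/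
theorem electrostatic_energy_expansion (N : ℕ) (q : Fin N → ℝ)
    (z : Fin N → EuclideanSpace ℝ (Fin 3)) (hz : Function.Injective z)
    (E : EuclideanSpace ℝ (Fin 3) → EuclideanSpace ℝ (Fin 3))
    (hE : ∀ x, E x = (4 * Real.pi)⁻¹ • ∑ n, (q n / ‖x - z n‖ ^ 3) • (x - z n)) :
    (fun r : ℝ =>
        (1 / 2) * (∫ x in {x | ∀ n, r < dist x (z n)}, ‖E x‖ ^ 2) -
          ((8 * Real.pi * r)⁻¹ * ∑ n, (q n) ^ 2 +
            (4 * Real.pi)⁻¹ *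
              ∑ n, ∑ m, if n < m then q n * q m / dist (z n) (z m) else 0))
      =O[𝓝[>] (0 : ℝ)] id := by
  have hO : (fun r : ℝ => ∑ n, ∑ m, (1 / 2 * (4 * Real.pi)⁻¹ ^ 2 * (q n * q m)) *
      ((∫ x in {x | ∀ n, r < dist x (z n)}, coulombProduct (z n) (z m) x) -
        (if n = m then 4 * Real.pi / r else 4 * Real.pi / dist (z n) (z m))))
      =O[𝓝[>] (0 : ℝ)] id := by
    refine IsBigO.fun_sum fun n _ => IsBigO.fun_sum fun m _ => IsBigO.const_mul_left ?_ _
    obtain ⟨C, hC⟩ := exists_abs_setIntegral_coulombProduct_sub_le hz n m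
    refine IsBigO.of_bound C ?_
    filter_upwards [self_mem_nhdsWithin] with r hr
    have hr : 0 < r := hr
    simpa [abs_of_pos hr] using hC r hr
  refine hO.congr' ?_ .rfl
  filter_upwards [self_mem_nhdsWithin] with r hr
  have hr : 0 < r := hr
  have hint : ∫ x in {x | ∀ n, r < dist x (z n)}, ‖E x‖ ^ 2 =
      (4 * Real.pi)⁻¹ ^ 2 * ∑ n, ∑ m, q n * q m *
        ∫ x in {x | ∀ n, r < dist x (z n)}, coulombProduct (z n) (z m) x := by
    have hE2 : ∀ x, ‖E x‖ ^ 2 = (4 * Real.pi)⁻¹ ^ 2 *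
        ∑ n, ∑ m, q n * q m * coulombProduct (z n) (z m) x := by
      intro x
      rw [hE, norm_smul, mul_pow, norm_sq_sum_coulomb, Real.norm_eq_abs, sq_abs]
    simp only [hE2]
    have hi := fun n m => (integrableOn_coulombProduct hz n m hr).const_mul (q n * q m)
    rw [integral_const_mul, integral_finsetSum _ fun n _ => integrable_finsetSum _ fun m _ => hi n m]
    congr 1
    refine Finset.sum_congr rfl fun n _ => ?_
    rw [integral_finsetSum _ fun m _ => hi n m]
    exact Finset.sum_congr rfl fun m _ => integral_const_mul _ _
  have hT : ∑ n, ∑ m, q n * q m *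
      (if n = m then 4 * Real.pi / r else 4 * Real.pi / dist (z n) (z m)) =
      (4 * Real.pi) * (r⁻¹ * ∑ n, q n ^ 2 +
        2 * ∑ n, ∑ m, if n < m then q n * q m / dist (z n) (z m) else 0) := by
    have h := sum_sum_eq_sum_diag_add (fun n m : Fin N => r⁻¹ * (q n * q m))
      (fun n m => q n * q m / dist (z n) (z m)) fun n m => by rw [dist_comm, mul_comm (q n)]
    simp only [sq, Finset.mul_sum (Finset.univ) (fun n => q n * q n) r⁻¹]
    rw [← h, Finset.mul_sum]
    refine Finset.sum_congr rfl fun n _ => ?_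
    rw [Finset.mul_sum]
    refine Finset.sum_congr rfl fun m _ => ?_
    split_ifs <;> ring
  simp only [mul_sub, Finset.sum_sub_distrib, mul_assoc, ← Finset.mul_sum] at hT hint ⊢
  rw [hint, hT]
  field_simp
  ring
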